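/- (Systems of polynomial equations.) For every dimension m ≥ 1 and every degree bound d ≥ 1 there exists τ_0 ∈ (0,1), depending only on m and d, with the following property: for any real polynomials P_1, …, P_N in m variables each of degree at most d, with f := P_1² + … + P_N² : ℝ^m → ℝ, and any sequence {x_n} generated by New Q-Newton's method Backtracking G applied to f with parameter τ satisfying 0 < τ ≤ τ_0, exactly one of the following holds: (i) lim_{n→∞} ‖x_n‖ = ∞, or (ii) the whole sequence {x_n} converges to a critical point of f. -/

import Mathlib

open scoped RealInnerProductSpace
open Filter Topology

noncomputable section

/-- ℝ^m with the Euclidean inner product and norm. -/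
abbrev Euc (m : ℕ) := EuclideanSpace ℝ (Fin m)

/-- `minsp A = min_{‖e‖=1} ‖A e‖`. -/
def minsp {m : ℕ} (A : Euc m →L[ℝ] Euc m) : ℝ :=
  sInf {r : ℝ | ∃ e : Euc m, ‖e‖ = 1 ∧ r = ‖A e‖}

/-- `κ = (1/2) · min_{i≠j} |δ_i − δ_j|`. -/
def kappa {m : ℕ} (δ : Fin (m + 1) → ℝ) : ℝ :=
  (1 / 2) * sInf {r : ℝ | ∃ i j : Fin (m + 1), i ≠ j ∧ r = |δ i - δ j|}

/-- The Hessian `∇²f(x)` of `f` at `x`, as a continuous linear map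
(the derivative of the gradient). -/
def hessOp {m : ℕ} (f : Euc m → ℝ) (x : Euc m) : Euc m →L[ℝ] Euc m :=
  fderiv ℝ (gradient f) x

/-- `A(x) = ∇²f(x) + δ_j ‖∇f(x)‖^τ · Id`. -/
def Aop {m : ℕ} (f : Euc m → ℝ) (δj τ : ℝ) (x : Euc m) : Euc m →L[ℝ] Euc m :=
  hessOp f x + (δj * ‖gradient f x‖ ^ τ) • ContinuousLinearMap.id ℝ (Euc m)

/-- The index `j` is acceptable at `x`: `minsp(∇²f(x) + δ_j‖∇f(x)‖^τ Id) ≥ κ‖∇f(x)‖^τ`. -/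
def goodIdx {m : ℕ} (δ : Fin (m + 1) → ℝ) (τ : ℝ) (f : Euc m → ℝ) (x : Euc m)
    (j : Fin (m + 1)) : Prop :=
  kappa δ * ‖gradient f x‖ ^ τ ≤ minsp (Aop f (δ j) τ x)

/-- The step direction `w = Σᵢ (⟨∇f(x), eᵢ⟩/‖A eᵢ‖) eᵢ`. -/
def dirW {m : ℕ} (f : Euc m → ℝ) (A : Euc m →L[ℝ] Euc m) (e : Fin m → Euc m) (x : Euc m) :
    Euc m :=
  ∑ i : Fin m, (⟪gradient f x, e i⟫ / ‖A (e i)‖) • e i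

/-- The normalised step direction `ŵ = w / max{1, ‖w‖}`. -/
def hatW {m : ℕ} (f : Euc m → ℝ) (A : Euc m →L[ℝ] Euc m) (e : Fin m → Euc m) (x : Euc m) :
    Euc m :=
  (max 1 ‖dirW f A e x‖)⁻¹ • dirW f A e x

/-- Armijo's condition: `f(x − γ v) − f(x) ≤ −(1/3) γ ⟨v, ∇f(x)⟩`. -/
def armijo {m : ℕ} (f : Euc m → ℝ) (x v : Euc m) (γ : ℝ) : Prop :=
  f (x - γ • v) - f x ≤ -(γ * ⟪v, gradient f x⟫) / 3

/-- One step of New Q-Newton's method Backtracking G, with orthonormal basis `e`,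
selected index `j` (the least acceptable index), current point `x` and next point `x'`. -/
def IsQNGStep {m : ℕ} (δ : Fin (m + 1) → ℝ) (τ γ0 : ℝ) (f : Euc m → ℝ)
    (e : Fin m → Euc m) (j : Fin (m + 1)) (x x' : Euc m) : Prop :=
  (gradient f x = 0 → x' = x) ∧
  (gradient f x ≠ 0 →
    goodIdx δ τ f x j ∧ (∀ j' : Fin (m + 1), j' < j → ¬ goodIdx δ τ f x j') ∧
    ∃ p : ℕ,
      armijo f x (hatW f (Aop f (δ j) τ x) e x) (γ0 * (1 / 3) ^ p) ∧
      (∀ q : ℕ, q < p → ¬ armijo f x (hatW f (Aop f (δ j) τ x) e x) (γ0 * (1 / 3) ^ q)) ∧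
      x' = x - (γ0 * (1 / 3) ^ p) • hatW f (Aop f (δ j) τ x) e x)

/-- `x : ℕ → ℝ^m` is generated by New Q-Newton's method Backtracking G, with
orthonormal bases `e n` and selected indices `j n` at step `n`. -/
def IsQNGSeq {m : ℕ} (δ : Fin (m + 1) → ℝ) (τ γ0 : ℝ) (f : Euc m → ℝ)
    (e : ℕ → Fin m → Euc m) (j : ℕ → Fin (m + 1)) (x : ℕ → Euc m) : Prop :=
  ∀ n : ℕ, Orthonormal ℝ (e n) ∧ IsQNGStep δ τ γ0 f (e n) (j n) (x n) (x (n + 1))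

theorem polyChain {K κ : Type*} [Field K] [Field κ] [Algebra K κ] {m : ℕ}
    (f : MvPolynomial (Fin m) K) (p : Fin m → Polynomial κ) :
    Polynomial.derivative (MvPolynomial.aeval p f) =
      ∑ j, MvPolynomial.aeval p (MvPolynomial.pderiv j f) * Polynomial.derivative (p j) := by
  induction f using MvPolynomial.induction_on with
  | C a =>
    simp [MvPolynomial.algebraMap_eq, IsScalarTower.algebraMap_apply K κ (Polynomial κ)]
  | add f g hf hg => simp [hf, hg, add_mul, Finset.sum_add_distrib]
  | mul_X f i hf =>
    simp only [map_mul, Polynomial.derivative_mul, hf, MvPolynomial.aeval_X, Derivation.leibniz,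
      MvPolynomial.pderiv_X, smul_eq_mul, map_add, add_mul, Finset.sum_add_distrib]
    rw [add_comm]
    congr 1
    · rw [Finset.sum_eq_single i]
      · simp
      · intro b _ hb; simp [Pi.single_apply, hb.symm]
      · simp
    · rw [Finset.sum_mul]; apply Finset.sum_congr rfl; intros; ring

theorem dvr_lemma {K V : Type*} [Field K] [CharZero K] [CommRing V] [IsDomain V]
    [IsDiscreteValuationRing V] [Algebra K V] [Algebra.EssFiniteType K V] {m : ℕ}
    (f : MvPolynomial (Fin m) K) (y : Fin m → V)
    (hf : MvPolynomial.aeval y f ≠ 0) (hfu : ¬ IsUnit (MvPolynomial.aeval y f))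
    (h : ∀ j, MvPolynomial.aeval y f ∣ MvPolynomial.aeval y (MvPolynomial.pderiv j f)) :
    False := by
  obtain ⟨t, ht⟩ := IsDiscreteValuationRing.exists_irreducible V
  obtain ⟨n, hn⟩ := IsDiscreteValuationRing.associated_pow_irreducible hf ht
  have hn0 : n ≠ 0 := by
    rintro rfl
    rw [pow_zero] at hn
    exact hfu (associated_one_iff_isUnit.mp hn)
  let I1 : Ideal V := Ideal.span {t}
  let In : Ideal V := Ideal.span {t ^ (n + 1)}
  have hle : In ≤ I1 := by
    rw [Ideal.span_singleton_le_span_singleton]; exact dvd_pow_self t (by omega)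
  have hmax : I1.IsMaximal := PrincipalIdealRing.isMaximal_of_irreducible ht
  letI : Field (V ⧸ I1) := Ideal.Quotient.field I1
  let π : (V ⧸ In) →ₐ[K] (V ⧸ I1) := Ideal.Quotient.factorₐ K hle
  have hπ : Function.Surjective π := Ideal.Quotient.factor_surjective hle
  have hker : ∀ q : V ⧸ In, π q = 0 → ∃ q', q = Ideal.Quotient.mk In t * q' := by
    intro q hq
    obtain ⟨v, rfl⟩ := Ideal.Quotient.mk_surjective q
    have : Ideal.Quotient.mk I1 v = 0 := hq
    rw [Ideal.Quotient.eq_zero_iff_mem, Ideal.mem_span_singleton] at this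
    obtain ⟨w, rfl⟩ := this
    exact ⟨Ideal.Quotient.mk In w, by simp⟩
  have htn : (Ideal.Quotient.mk In t) ^ (n + 1) = 0 := by
    rw [← map_pow, Ideal.Quotient.eq_zero_iff_mem]; exact Ideal.mem_span_singleton_self _
  have hnil : IsNilpotent (RingHom.ker (π : (V ⧸ In) →+* (V ⧸ I1))) := by
    refine ⟨n + 1, ?_⟩
    have h1 : RingHom.ker (π : (V ⧸ In) →+* (V ⧸ I1)) ≤ Ideal.span {Ideal.Quotient.mk In t} := by
      intro q hq
      obtain ⟨q', rfl⟩ := hker q hq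
      exact Ideal.mul_mem_right _ _ (Ideal.mem_span_singleton_self _)
    have h2 := Ideal.pow_right_mono h1 (n + 1)
    rw [Ideal.span_singleton_pow, htn] at h2
    simpa using h2
  haveI : Algebra.EssFiniteType K (V ⧸ I1) := Algebra.EssFiniteType.comp K V (V ⧸ I1)
  let σ : (V ⧸ I1) →ₐ[K] (V ⧸ In) :=
    Algebra.FormallySmooth.liftOfSurjective (AlgHom.id K (V ⧸ I1)) π hπ hnil
  have hσ : ∀ c, π (σ c) = c := fun c =>
    Algebra.FormallySmooth.liftOfSurjective_apply (AlgHom.id K (V ⧸ I1)) π hπ hnil c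
  let e : Polynomial (V ⧸ I1) →ₐ[K] (V ⧸ In) :=
    { Polynomial.eval₂RingHom σ.toRingHom (Ideal.Quotient.mk In t) with
      commutes' := by
        intro r
        simp [IsScalarTower.algebraMap_apply K (V ⧸ I1) (Polynomial (V ⧸ I1))] }
  have eC : ∀ c, e (Polynomial.C c) = σ c := by intro c; simp [e]
  have eX : e Polynomial.X = Ideal.Quotient.mk In t := by simp [e]
  have esurj : ∀ k : ℕ, ∀ q, ∃ p q', q = e p + (Ideal.Quotient.mk In t) ^ k * q' := by
    intro k
    induction k with
    | zero => intro q; exact ⟨0, q, by simp⟩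
    | succ k ih =>
      intro q
      obtain ⟨q1, hq1⟩ := hker (q - σ (π q)) (by rw [map_sub, hσ, sub_self])
      obtain ⟨p, q', hp⟩ := ih q1
      refine ⟨Polynomial.C (π q) + Polynomial.X * p, q', ?_⟩
      rw [map_add, map_mul, eC, eX]
      rw [sub_eq_iff_eq_add] at hq1
      rw [hq1, hp]; simp only [map_add, map_mul, hσ, add_zero]
      have : π (Ideal.Quotient.mk In t) = 0 := by
        change Ideal.Quotient.mk I1 t = 0
        rw [Ideal.Quotient.eq_zero_iff_mem]; exact Ideal.mem_span_singleton_self _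
      rw [this]; simp; ring
  have esurj' : Function.Surjective e := by
    intro q
    obtain ⟨p, q', hp⟩ := esurj (n + 1) q
    exact ⟨p, by rw [hp, htn]; simp⟩
  have eord : ∀ k ≤ n + 1, ∀ q : Polynomial (V ⧸ I1),
      (Ideal.Quotient.mk In t) ^ k ∣ e q → Polynomial.X ^ k ∣ q := by
    intro k
    induction k with
    | zero => intro _ q _; simp
    | succ k ih =>
      intro hk q hq
      obtain ⟨r, rfl⟩ := ih (by omega) q ((pow_dvd_pow _ (Nat.le_succ k)).trans hq)
      rw [pow_succ]
      refine mul_dvd_mul_left _ ?_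
      rw [Polynomial.X_dvd_iff]
      by_contra hr
      obtain ⟨w, hw⟩ := hq
      obtain ⟨v, hv⟩ := Ideal.Quotient.mk_surjective (e r)
      obtain ⟨w', hw'⟩ := Ideal.Quotient.mk_surjective w
      rw [map_mul, map_pow, eX, ← hv, ← hw', ← map_pow, ← map_pow, ← map_mul, ← map_mul,
        Ideal.Quotient.eq, Ideal.mem_span_singleton] at hw
      have h3 : t ^ (k + 1) ∣ t ^ k * v := by
        have := (pow_dvd_pow t hk).trans hw
        rwa [dvd_sub_left (Dvd.intro _ rfl)] at this
      rw [pow_succ] at h3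
      have h4 : t ∣ v := (mul_dvd_mul_iff_left (pow_ne_zero k ht.ne_zero)).mp h3
      have h5 : π (e r) = 0 := by
        rw [← hv]
        change Ideal.Quotient.mk I1 v = 0
        rw [Ideal.Quotient.eq_zero_iff_mem, Ideal.mem_span_singleton]; exact h4
      have h6 : π (e r) = r.coeff 0 := by
        conv_lhs => rw [← Polynomial.divX_mul_X_add r]
        rw [map_add, map_mul, eX, eC, map_add, map_mul, hσ]
        have : π (Ideal.Quotient.mk In t) = 0 := by
          change Ideal.Quotient.mk I1 t = 0
          rw [Ideal.Quotient.eq_zero_iff_mem]; exact Ideal.mem_span_singleton_self _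
        rw [this]; simp
      exact hr (h6 ▸ h5)
  choose p hp using fun j => esurj' (Ideal.Quotient.mk In (y j))
  have hev : ∀ g : MvPolynomial (Fin m) K,
      e (MvPolynomial.aeval p g) = Ideal.Quotient.mk In (MvPolynomial.aeval y g) := by
    intro g
    have : (e.comp (MvPolynomial.aeval p)) =
        ((Ideal.Quotient.mkₐ K In).comp (MvPolynomial.aeval y)) := by
      apply MvPolynomial.algHom_ext
      intro i; simp [hp]
    exact congrArg (fun φ => φ g) this
  have hfn : Polynomial.X ^ n ∣ MvPolynomial.aeval p f := by
    apply eord n (by omega)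
    rw [hev, ← map_pow]
    exact map_dvd _ hn.symm.dvd
  have hgn : ∀ j, Polynomial.X ^ n ∣ MvPolynomial.aeval p (MvPolynomial.pderiv j f) := by
    intro j
    apply eord n (by omega)
    rw [hev, ← map_pow]
    exact map_dvd _ (hn.symm.dvd.trans (h j))
  have hder : Polynomial.X ^ n ∣ Polynomial.derivative (MvPolynomial.aeval p f) := by
    rw [polyChain]
    exact Finset.dvd_sum fun j _ => (hgn j).mul_right _
  obtain ⟨r, hr⟩ := hfn
  obtain ⟨n, rfl⟩ := Nat.exists_eq_succ_of_ne_zero hn0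
  have hchar : CharZero (V ⧸ I1) := charZero_of_injective_algebraMap (algebraMap K (V ⧸ I1)).injective
  rw [hr, Polynomial.derivative_mul, dvd_add_left (Dvd.intro _ rfl), Polynomial.derivative_X_pow] at hder
  have h7 : (Polynomial.X : Polynomial (V ⧸ I1)) ∣ r := by
    have h8 : (Polynomial.X : Polynomial (V ⧸ I1)) ^ n * Polynomial.X ∣
        Polynomial.X ^ n * (Polynomial.C ((n.succ : ℕ) : V ⧸ I1) * r) := by
      have e1 : (Polynomial.X : Polynomial (V ⧸ I1)) ^ n * (Polynomial.C ((n.succ : ℕ) : V ⧸ I1) * r)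
          = Polynomial.C ((n.succ : ℕ) : V ⧸ I1) * Polynomial.X ^ (n.succ - 1) * r := by
        rw [Nat.succ_sub_one]; ring
      rw [e1, ← pow_succ]
      exact hder
    have h9 := (mul_dvd_mul_iff_left (pow_ne_zero n Polynomial.X_ne_zero)).mp h8
    rw [Polynomial.X_dvd_iff] at h9 ⊢
    rw [Polynomial.coeff_C_mul] at h9
    exact (mul_eq_zero.mp h9).resolve_left (Nat.cast_ne_zero.mpr (Nat.succ_ne_zero n))
  obtain ⟨s, rfl⟩ := h7
  have h10 : Ideal.Quotient.mk In (MvPolynomial.aeval y f) = 0 := by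
    rw [← hev, hr, ← mul_assoc, ← pow_succ, map_mul, map_pow, eX, htn, zero_mul]
  rw [Ideal.Quotient.eq_zero_iff_mem, Ideal.mem_span_singleton] at h10
  have h11 := h10.trans hn.dvd
  exact ht.not_isUnit (pow_dvd_pow_iff ht.ne_zero ht.not_isUnit |>.mp h11 |> fun h => absurd h (by omega))

theorem unit_normal {K C : Type*} [Field K] [CharZero K] [CommRing C] [IsDomain C]
    [IsIntegrallyClosed C] [IsNoetherianRing C] [Algebra K C] [Algebra.FiniteType K C] {m : ℕ}
    (f : MvPolynomial (Fin m) K) (y : Fin m → C)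
    (hf : MvPolynomial.aeval y f ≠ 0)
    (h : ∀ j, MvPolynomial.aeval y f ∣ MvPolynomial.aeval y (MvPolynomial.pderiv j f)) :
    IsUnit (MvPolynomial.aeval y f) := by
  by_contra hfu
  set a := MvPolynomial.aeval y f with ha
  obtain ⟨P, hP⟩ := (Ideal.span {a}).nonempty_minimalPrimes (by simpa using hfu)
  have hPp : P.IsPrime := hP.1.1
  have haP : a ∈ P := hP.1.2 (Ideal.mem_span_singleton_self a)
  have hht : P.height ≤ 1 :=
    Ideal.height_le_one_of_isPrincipal_of_mem_minimalPrimes (Ideal.span {a}) P hP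
  let V := Localization.AtPrime P
  have hinj : Function.Injective (algebraMap C V) :=
    IsLocalization.injective V P.primeCompl_le_nonZeroDivisors
  have hmem : algebraMap C V a ∈ IsLocalRing.maximalIdeal V :=
    (IsLocalization.AtPrime.to_map_mem_maximal_iff V P a).mpr haP
  have ha0 : algebraMap C V a ≠ 0 := by
    rw [Ne, map_eq_zero_iff _ hinj]; exact hf
  have hdom : IsDomain V := IsLocalization.isDomain_localization P.primeCompl_le_nonZeroDivisors
  have hic : IsIntegrallyClosed V :=
    isIntegrallyClosed_of_isLocalization V P.primeCompl P.primeCompl_le_nonZeroDivisors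
  have hnoeth : IsNoetherianRing V := IsLocalization.isNoetherianRing P.primeCompl V inferInstance
  have hnf : ¬ IsField V := by
    intro hF
    rw [IsLocalRing.isField_iff_maximalIdeal_eq] at hF
    rw [hF] at hmem
    exact ha0 hmem
  have hbot : IsLocalRing.maximalIdeal V ≠ ⊥ := by
    intro hF; rw [hF] at hmem; exact ha0 hmem
  have hdvr : IsDiscreteValuationRing V := by
    have htf : IsIntegrallyClosed V ∧ (∃! P : Ideal V, P ≠ ⊥ ∧ P.IsPrime) → IsDiscreteValuationRing V :=
      ((IsDiscreteValuationRing.TFAE V hnf).out 3 0).mp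
    refine htf ⟨hic, IsLocalRing.maximalIdeal V, ⟨hbot, inferInstance⟩, ?_⟩
    rintro Q ⟨hQ0, hQ⟩
    have hQle : Q ≤ IsLocalRing.maximalIdeal V := IsLocalRing.le_maximalIdeal hQ.ne_top
    by_contra hne
    have hlt : Q < IsLocalRing.maximalIdeal V := lt_of_le_of_ne hQle hne
    have hQb : (⊥ : Ideal V) < Q := bot_lt_iff_ne_bot.mpr hQ0
    have hh : (IsLocalRing.maximalIdeal V).height ≤ 1 := by
      rw [← IsLocalization.height_under P.primeCompl,
        Localization.AtPrime.under_maximalIdeal]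
      exact hht
    have h1 : (Q.height) + 1 ≤ (IsLocalRing.maximalIdeal V).height :=
      Ideal.height_add_one_le_of_lt_of_isPrime hlt
    have h2 : ((⊥ : Ideal V).height) + 1 ≤ Q.height :=
      Ideal.height_add_one_le_of_lt_of_isPrime hQb
    have h3 : (1 : ℕ∞) + 1 ≤ 1 := by
      calc (1 : ℕ∞) + 1 ≤ (⊥ : Ideal V).height + 1 + 1 := by gcongr; simp
        _ ≤ Q.height + 1 := by gcongr
        _ ≤ _ := h1.trans hh
    exact absurd h3 (by decide)
  have hess : Algebra.EssFiniteType K V := by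
    haveI : Algebra.EssFiniteType C V := Algebra.EssFiniteType.of_isLocalization V P.primeCompl
    exact Algebra.EssFiniteType.comp K C V
  have key : ∀ g : MvPolynomial (Fin m) K,
      MvPolynomial.aeval (fun j => algebraMap C V (y j)) g =
        algebraMap C V (MvPolynomial.aeval y g) := by
    intro g
    exact (MvPolynomial.aeval_algebraMap_apply V y g)
  refine dvr_lemma (K := K) (V := V) f (fun j => algebraMap C V (y j)) ?_ ?_ ?_
  · rw [key]; exact ha0
  · rw [key]; exact hmem
  · intro j; rw [key, key]; exact map_dvd _ (h j)

theorem unit_lemma_aux {K A T : Type*} [Field K] [CharZero K] [CommRing T] [IsDomain T]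
    [CommRing A] [IsDomain A] [IsIntegrallyClosed A] [IsNoetherianRing A]
    [Algebra K A] [Algebra.FiniteType K A] [Algebra A T] [Module.Finite A T] [FaithfulSMul A T]
    [Algebra K T] [IsScalarTower K A T] {m : ℕ}
    (f : MvPolynomial (Fin m) K) (y : Fin m → T)
    (hf : MvPolynomial.aeval y f ≠ 0)
    (h : ∀ j, MvPolynomial.aeval y f ∣ MvPolynomial.aeval y (MvPolynomial.pderiv j f)) :
    IsUnit (MvPolynomial.aeval y f) := by
  let L := FractionRing T
  have hAT : Function.Injective (algebraMap A T) := FaithfulSMul.algebraMap_injective A T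
  have : FaithfulSMul A L := by
    rw [faithfulSMul_iff_algebraMap_injective, IsScalarTower.algebraMap_eq A T L]
    exact (IsFractionRing.injective T L).comp hAT
  let F := FractionRing A
  let _ : Algebra F L := FractionRing.liftAlgebra A L
  have : IsScalarTower A F L := FractionRing.isScalarTower_liftAlgebra A L
  have : Algebra.IsIntegral A T := inferInstance
  have : Algebra.IsAlgebraic F L := isAlgebraic_of_isFractionRing A T ..
  have : FiniteDimensional F L := by
    have : Algebra.EssFiniteType T L := Algebra.EssFiniteType.of_isLocalization L (nonZeroDivisors T)
    have : Algebra.EssFiniteType A L := Algebra.EssFiniteType.comp A T L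
    have : Algebra.EssFiniteType F L := Algebra.EssFiniteType.of_comp A F L
    obtain ⟨S, hS⟩ := IntermediateField.fg_top F L
    have h1 : FiniteDimensional F (IntermediateField.adjoin F (S : Set L)) :=
      IntermediateField.finiteDimensional_adjoin (fun x _ => Algebra.IsIntegral.isIntegral x)
    rw [hS] at h1
    exact IntermediateField.topEquiv.toLinearEquiv.finiteDimensional
  have : CharZero F := by
    have : CharZero A := charZero_of_injective_algebraMap (algebraMap K A).injective
    infer_instance
  let C := integralClosure A L
  have : IsNoetherianRing C := IsIntegralClosure.isNoetherianRing A F L C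
  have : Module.Finite A C := IsIntegralClosure.finite A F L C
  have : IsIntegrallyClosed C := integralClosure.isIntegrallyClosedOfFiniteExtension F
  let _ : Algebra K C := ((algebraMap A C).comp (algebraMap K A)).toAlgebra
  have : IsScalarTower K A C := IsScalarTower.of_algebraMap_eq' rfl
  have : Algebra.FiniteType K C := Algebra.FiniteType.trans (S := A) inferInstance inferInstance
  let ι : T →ₐ[A] C :=
    (IsScalarTower.toAlgHom A T L).codRestrict C
      (fun t => (Algebra.IsIntegral.isIntegral (R := A) t).algebraMap)
  have hιinj : Function.Injective ι := by
    intro a b hab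
    exact IsFractionRing.injective T L (congrArg Subtype.val hab)
  have hιint : ι.toRingHom.IsIntegral := by
    intro c
    have h1 : IsIntegral A c := Algebra.IsIntegral.isIntegral c
    obtain ⟨p, hp, hpc⟩ := h1
    refine ⟨p.map (algebraMap A T), hp.map _, ?_⟩
    rw [Polynomial.eval₂_map]
    have : ι.toRingHom.comp (algebraMap A T) = algebraMap A C := ι.comp_algebraMap
    rw [this]
    exact hpc
  have hloc' : IsLocalHom ι.toRingHom := hιint.isLocalHom hιinj
  have key : ∀ g : MvPolynomial (Fin m) K,
      MvPolynomial.aeval (fun j => ι (y j)) g = ι (MvPolynomial.aeval y g) := by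
    intro g
    have := MvPolynomial.map_aeval y (ι.toRingHom) g
    have h2 : ι.toRingHom.comp (algebraMap K T) = algebraMap K C := by
      rw [IsScalarTower.algebraMap_eq K A T, ← RingHom.comp_assoc]
      have : ι.toRingHom.comp (algebraMap A T) = algebraMap A C := ι.comp_algebraMap
      rw [this]; rfl
    rw [h2] at this
    exact this.symm
  apply isUnit_of_map_unit ι.toRingHom
  change IsUnit (ι _)
  rw [← key]
  refine unit_normal f _ ?_ ?_
  · rw [key, Ne, map_eq_zero_iff _ hιinj]; exact hf
  · intro j; rw [key, key]; exact map_dvd _ (h j)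

theorem unit_lemma {K T : Type*} [Field K] [CharZero K] [CommRing T] [IsDomain T]
    [Algebra K T] [Algebra.FiniteType K T] {m : ℕ}
    (f : MvPolynomial (Fin m) K) (y : Fin m → T)
    (hf : MvPolynomial.aeval y f ≠ 0)
    (h : ∀ j, MvPolynomial.aeval y f ∣ MvPolynomial.aeval y (MvPolynomial.pderiv j f)) :
    IsUnit (MvPolynomial.aeval y f) := by
  obtain ⟨s, g, ginj, gfin⟩ := exists_finite_inj_algHom_of_fg K T
  let _ : Algebra (MvPolynomial (Fin s) K) T := g.toRingHom.toAlgebra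
  have : Module.Finite (MvPolynomial (Fin s) K) T := gfin
  have : FaithfulSMul (MvPolynomial (Fin s) K) T :=
    (faithfulSMul_iff_algebraMap_injective _ T).mpr ginj
  have : IsScalarTower K (MvPolynomial (Fin s) K) T :=
    IsScalarTower.of_algebraMap_eq (fun x => (g.commutes x).symm)
  exact unit_lemma_aux (A := MvPolynomial (Fin s) K) f y hf h

theorem fld1 {L : Type*} [Field L] (x u v : L) (hu : u ≠ 0) (hv : v ≠ 0) :
    x = u * (v / u * (x / v)) := by
  field_simp

theorem fld2 {L : Type*} [Field L] (x u v : L) (hv : v ≠ 0) :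
    x * u = u * v * (x / v) := by
  field_simp

theorem fld3 {L : Type*} [Field L] (u v : L) (hu : u ≠ 0) :
    v * v = u * v * (v / u) := by
  field_simp

/-- The product of the gradient ideal and the ideal `(f, ∂ᵢ f)`. -/
def loIdeal {B : Type*} [CommRing B] {m : ℕ} (f : MvPolynomial (Fin m) B) (i : Fin m) :
    Ideal (MvPolynomial (Fin m) B) :=
  Ideal.span (Set.range fun j => MvPolynomial.pderiv j f) *
    Ideal.span {f, MvPolynomial.pderiv i f}

/-- The algebraic certificate for the gradient inequality. -/
def LoId {B : Type*} [CommRing B] {m : ℕ} (N : ℕ) (f : MvPolynomial (Fin m) B) (i : Fin m) : Prop :=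
  (f * MvPolynomial.pderiv i f) ^ N ∈ Ideal.span {f} * loIdeal f i ^ N

theorem mem_loIdeal {B : Type*} [CommRing B] {m : ℕ} (f : MvPolynomial (Fin m) B) (i : Fin m) :
    f * MvPolynomial.pderiv i f ∈ loIdeal f i := by
  rw [mul_comm]
  exact Ideal.mul_mem_mul (Ideal.subset_span ⟨i, rfl⟩) (Ideal.subset_span (by simp))

theorem LoId.mono {B : Type*} [CommRing B] {m : ℕ} {N N' : ℕ} (hN : N ≤ N')
    {f : MvPolynomial (Fin m) B} {i : Fin m} (h : LoId N f i) : LoId N' f i := by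
  obtain ⟨k, rfl⟩ := Nat.exists_eq_add_of_le hN
  unfold LoId at *
  rw [pow_add, pow_add, ← mul_assoc]
  exact Ideal.mul_mem_mul h (Ideal.pow_mem_pow (mem_loIdeal f i) k)

theorem loId_field {K : Type*} [Field K] [CharZero K] {m : ℕ}
    (f : MvPolynomial (Fin m) K) (i : Fin m) : ∃ N, LoId N f i := by
  set g := MvPolynomial.pderiv i f with hg
  by_cases hf0 : f = 0
  · refine ⟨1, ?_⟩
    simp [LoId, hf0]
  by_cases hg0 : g = 0
  · refine ⟨1, ?_⟩
    simp [LoId, ← hg, hg0]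
  let R := MvPolynomial (Fin m) K
  let L := FractionRing R
  let a : R →ₐ[K] L := IsScalarTower.toAlgHom K R L
  have hainj : Function.Injective a := IsFractionRing.injective R L
  have haf : a f ≠ 0 := by rw [Ne, map_eq_zero_iff _ hainj]; exact hf0
  have hag : a g ≠ 0 := by rw [Ne, map_eq_zero_iff _ hainj]; exact hg0
  let S : Set L := (Set.range fun j => a (MvPolynomial.X j)) ∪
    (Set.range fun j => a (MvPolynomial.pderiv j f) / a g) ∪ {a g / a f}
  have hSfin : S.Finite :=
    ((Set.finite_range _).union (Set.finite_range _)).union (Set.finite_singleton _)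
  let T := Algebra.adjoin K S
  have hTft : Algebra.FiniteType K T :=
    (Subalgebra.fg_iff_finiteType T).mp (Subalgebra.fg_def.mpr ⟨S, hSfin, rfl⟩)
  let y : Fin m → T := fun j => ⟨a (MvPolynomial.X j),
    Algebra.subset_adjoin (Or.inl (Or.inl ⟨j, rfl⟩))⟩
  have key : ∀ p : R, ((MvPolynomial.aeval y p : T) : L) = a p := by
    intro p
    have : T.val.comp (MvPolynomial.aeval y) = a := by
      apply MvPolynomial.algHom_ext
      intro j; simp [y]
    exact congrArg (fun φ => φ p) this
  have hu : IsUnit (MvPolynomial.aeval y f) := by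
    apply unit_lemma
    · intro h0
      apply haf
      rw [← key, h0]; rfl
    · intro j
      refine ⟨⟨a g / a f, Algebra.subset_adjoin (Or.inr rfl)⟩ *
        ⟨a (MvPolynomial.pderiv j f) / a g, Algebra.subset_adjoin (Or.inl (Or.inr ⟨j, rfl⟩))⟩, ?_⟩
      apply Subtype.ext
      rw [key, MulMemClass.coe_mul, key, MulMemClass.coe_mul]
      exact fld1 _ _ _ haf hag
  obtain ⟨τ, hτ⟩ := hu.exists_right_inv
  have hup : ∀ (N k : ℕ) (t : L), (∃ b ∈ loIdeal f i ^ N, a b = a (f * g) ^ N * t) →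
      ∃ b ∈ loIdeal f i ^ (N + k), a b = a (f * g) ^ (N + k) * t := by
    rintro N k t ⟨b, hb, hbt⟩
    refine ⟨b * (f * g) ^ k, ?_, ?_⟩
    · rw [pow_add]; exact Ideal.mul_mem_mul hb (Ideal.pow_mem_pow (mem_loIdeal f i) k)
    · rw [map_mul, hbt, map_pow, pow_add]; ring
  have hall : ∀ t ∈ T, ∃ N, ∃ b ∈ loIdeal f i ^ N, a b = a (f * g) ^ N * t := by
    intro t ht
    induction ht using Algebra.adjoin_induction with
    | mem t ht =>
      rcases ht with (⟨j, rfl⟩ | ⟨j, rfl⟩) | rfl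
      · exact ⟨0, MvPolynomial.X j, by simp, by simp⟩
      · refine ⟨1, MvPolynomial.pderiv j f * f, ?_, ?_⟩
        · rw [pow_one]
          exact Ideal.mul_mem_mul (Ideal.subset_span ⟨j, rfl⟩) (Ideal.subset_span (by simp))
        · simp only [map_mul, pow_one]; exact fld2 _ _ _ hag
      · refine ⟨1, g * g, ?_, ?_⟩
        · rw [pow_one]
          exact Ideal.mul_mem_mul (Ideal.subset_span ⟨i, rfl⟩) (Ideal.subset_span (by simp [hg]))
        · simp only [map_mul, pow_one]; exact fld3 _ _ haf
    | algebraMap r => exact ⟨0, algebraMap K R r, by simp, by simp⟩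
    | add x y _ _ hx hy =>
      obtain ⟨N1, h1⟩ := hx
      obtain ⟨N2, h2⟩ := hy
      obtain ⟨b1, hb1, e1⟩ := hup N1 N2 _ h1
      obtain ⟨b2, hb2, e2⟩ := hup N2 N1 _ h2
      rw [add_comm N2 N1] at hb2 e2
      exact ⟨N1 + N2, b1 + b2, Ideal.add_mem _ hb1 hb2, by rw [map_add, e1, e2]; ring⟩
    | mul x y _ _ hx hy =>
      obtain ⟨N1, b1, hb1, e1⟩ := hx
      obtain ⟨N2, b2, hb2, e2⟩ := hy
      refine ⟨N1 + N2, b1 * b2, ?_, by rw [map_mul, e1, e2]; ring⟩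
      rw [pow_add]; exact Ideal.mul_mem_mul hb1 hb2
  obtain ⟨N, b, hb, hbt⟩ := hall τ τ.2
  refine ⟨N, ?_⟩
  have h1 : a f * (τ : L) = 1 := by
    rw [← key, ← MulMemClass.coe_mul, hτ]; rfl
  have h2 : (f * g) ^ N = f * b := by
    apply hainj
    rw [map_mul, hbt, map_pow]
    linear_combination (-(a (f * g)) ^ N) * h1
  unfold LoId
  rw [← hg, h2]
  exact Ideal.mul_mem_mul (Ideal.mem_span_singleton_self f) hb

theorem loIdeal_map {B B' : Type*} [CommRing B] [CommRing B'] {m : ℕ} (ψ : B →+* B')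
    (f : MvPolynomial (Fin m) B) (i : Fin m) :
    Ideal.map (MvPolynomial.map ψ) (loIdeal f i) = loIdeal (MvPolynomial.map ψ f) i := by
  unfold loIdeal
  rw [Ideal.map_mul, Ideal.map_span, Ideal.map_span, ← Set.range_comp, Set.image_pair]
  simp only [Function.comp_def, MvPolynomial.pderiv_map]

theorem loFull_map {B B' : Type*} [CommRing B] [CommRing B'] {m : ℕ} (ψ : B →+* B')
    (f : MvPolynomial (Fin m) B) (i : Fin m) (N : ℕ) :
    Ideal.map (MvPolynomial.map ψ) (Ideal.span {f} * loIdeal f i ^ N) =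
      Ideal.span {MvPolynomial.map ψ f} * loIdeal (MvPolynomial.map ψ f) i ^ N := by
  rw [Ideal.map_mul, Ideal.map_pow, loIdeal_map, Ideal.map_span, Set.image_singleton]

theorem loId_prime {B K : Type*} [CommRing B] [IsDomain B] [Field K] [CharZero K] [Algebra B K]
    [IsFractionRing B K] {m : ℕ} (F : MvPolynomial (Fin m) B) (i : Fin m) :
    ∃ N, ∃ b : B, b ≠ 0 ∧ (F * MvPolynomial.pderiv i F) ^ N * MvPolynomial.C b ∈
      Ideal.span {F} * loIdeal F i ^ N := by
  obtain ⟨N, hN⟩ := loId_field (MvPolynomial.map (algebraMap B K) F) i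
  unfold LoId at hN
  rw [← loFull_map, MvPolynomial.pderiv_map, ← map_mul, ← map_pow] at hN
  let _ : Algebra (MvPolynomial (Fin m) B) (MvPolynomial (Fin m) K) :=
    MvPolynomial.algebraMvPolynomial
  have halg : (MvPolynomial.map (algebraMap B K) : MvPolynomial (Fin m) B →+* MvPolynomial (Fin m) K)
    = algebraMap (MvPolynomial (Fin m) B) (MvPolynomial (Fin m) K) := rfl
  rw [halg] at hN
  rw [IsLocalization.mem_map_algebraMap_iff
    (Submonoid.map (MvPolynomial.C : B →+* MvPolynomial (Fin m) B) (nonZeroDivisors B))] at hN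
  obtain ⟨⟨⟨w, hw⟩, ⟨s, hs⟩⟩, hx⟩ := hN
  obtain ⟨b, hb, rfl⟩ := hs
  rw [← map_mul] at hx
  have hinj : Function.Injective (algebraMap (MvPolynomial (Fin m) B) (MvPolynomial (Fin m) K)) :=
    MvPolynomial.map_injective _ (IsFractionRing.injective B K)
  have hx' := hinj hx
  refine ⟨N, b, nonZeroDivisors.ne_zero hb, ?_⟩
  simp only at hx'
  rw [hx']
  exact hw

theorem loId_spread {A : Type*} [CommRing A] [Algebra ℚ A] [IsNoetherianRing A] {m : ℕ}
    (F : MvPolynomial (Fin m) A) (i : Fin m) (I : Ideal A) :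
    ∃ N, ∀ φ : A →+* ℝ, I ≤ RingHom.ker φ → LoId N (MvPolynomial.map φ F) i := by
  refine IsNoetherian.induction (R := A) (M := A) (P := fun I : Ideal A =>
    ∃ N, ∀ φ : A →+* ℝ, I ≤ RingHom.ker φ → LoId N (MvPolynomial.map φ F) i) ?_ I
  clear I
  intro I0 ih0
  obtain ⟨I, hII⟩ : ∃ I : Ideal A, I = I0 := ⟨I0, rfl⟩
  subst hII
  have ih : ∀ J : Ideal A, I < J →
    ∃ N, ∀ φ : A →+* ℝ, J ≤ RingHom.ker φ → LoId N (MvPolynomial.map φ F) i := ih0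
  clear ih0
  by_cases htop : I = ⊤
  · refine ⟨0, fun φ hφ => ?_⟩
    have : (1 : A) ∈ RingHom.ker φ := hφ (htop ▸ Submodule.mem_top)
    simp [RingHom.mem_ker] at this
  by_cases hI : I.IsPrime
  · let B := A ⧸ I
    have hdom : IsDomain B := Ideal.Quotient.isDomain I
    let K := FractionRing B
    have hcB : CharZero B := algebraRat.charZero B
    have hcK : CharZero K := charZero_of_injective_algebraMap (IsFractionRing.injective B K)
    let FB : MvPolynomial (Fin m) B := MvPolynomial.map (Ideal.Quotient.mk I) F
    obtain ⟨N, b, hb, hw⟩ := loId_prime (K := K) FB i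
    obtain ⟨b', rfl⟩ := Ideal.Quotient.mk_surjective b
    have hb' : b' ∉ I := by
      intro hbI
      exact hb (Ideal.Quotient.eq_zero_iff_mem.mpr hbI)
    obtain ⟨N', hN'⟩ := ih (I ⊔ Ideal.span {b'}) (by
      refine lt_of_le_of_ne le_sup_left fun h => hb' ?_
      rw [h]; exact Ideal.mem_sup_right (Ideal.mem_span_singleton_self _))
    refine ⟨max N N', fun φ hφ => ?_⟩
    by_cases hφb : φ b' = 0
    · refine LoId.mono (le_max_right _ _) (hN' φ ?_)
      rw [sup_le_iff, Ideal.span_singleton_le_iff_mem]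
      exact ⟨hφ, hφb⟩
    · refine LoId.mono (le_max_left _ _) ?_
      let ψ : B →+* ℝ := Ideal.Quotient.lift I φ (fun a ha => hφ ha)
      have hψ : MvPolynomial.map φ F = MvPolynomial.map ψ FB := by
        rw [MvPolynomial.map_map]
        congr 1
      unfold LoId
      rw [hψ, ← loFull_map, MvPolynomial.pderiv_map, ← map_mul, ← map_pow]
      have h3 := Ideal.mem_map_of_mem (MvPolynomial.map ψ) hw
      rw [map_mul] at h3
      have hunit : IsUnit (MvPolynomial.map ψ (MvPolynomial.C (Ideal.Quotient.mk I b')) :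
          MvPolynomial (Fin m) ℝ) := by
        rw [MvPolynomial.map_C]
        exact (IsUnit.mk0 _ (show ψ (Ideal.Quotient.mk I b') ≠ 0 from hφb)).map MvPolynomial.C
      exact (Ideal.mul_unit_mem_iff_mem _ hunit).mp h3
  · rw [Ideal.isPrime_iff] at hI
    push Not at hI
    obtain ⟨a, b, hab, ha, hb⟩ := hI htop
    obtain ⟨N1, h1⟩ := ih (I ⊔ Ideal.span {a}) (by
      refine lt_of_le_of_ne le_sup_left fun h => ha ?_
      rw [h]; exact Ideal.mem_sup_right (Ideal.mem_span_singleton_self _))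
    obtain ⟨N2, h2⟩ := ih (I ⊔ Ideal.span {b}) (by
      refine lt_of_le_of_ne le_sup_left fun h => hb ?_
      rw [h]; exact Ideal.mem_sup_right (Ideal.mem_span_singleton_self _))
    refine ⟨max N1 N2, fun φ hφ => ?_⟩
    have h0 : φ a * φ b = 0 := by rw [← map_mul]; exact hφ hab
    rcases mul_eq_zero.mp h0 with h0 | h0
    · refine LoId.mono (le_max_left _ _) (h1 φ ?_)
      rw [sup_le_iff, Ideal.span_singleton_le_iff_mem]
      exact ⟨hφ, h0⟩
    · refine LoId.mono (le_max_right _ _) (h2 φ ?_)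
      rw [sup_le_iff, Ideal.span_singleton_le_iff_mem]
      exact ⟨hφ, h0⟩

theorem loId_uniform (m D : ℕ) : ∃ N, ∀ p : MvPolynomial (Fin m) ℝ, p.totalDegree ≤ D →
    ∀ i, LoId N p i := by
  classical
  let S : Set (Fin m →₀ ℕ) := {s | s.sum (fun _ e => e) ≤ D}
  have hS : S.Finite := by
    refine Set.Finite.subset (Set.finite_Iic (Finsupp.equivFunOnFinite.symm fun _ => D)) ?_
    intro s hs j
    simp only [Finsupp.equivFunOnFinite_symm_apply_apply]
    refine le_trans ?_ hs
    rw [Finsupp.sum_fintype _ _ (fun _ => rfl)]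
    exact Finset.single_le_sum (f := fun j => s j) (fun _ _ => Nat.zero_le _) (Finset.mem_univ j)
  let F : MvPolynomial (Fin m) (MvPolynomial hS.toFinset ℚ) :=
    ∑ s : hS.toFinset, MvPolynomial.monomial s.1 (MvPolynomial.X s)
  choose N hN using fun i => loId_spread F i ⊥
  refine ⟨Finset.univ.sup N, fun p hp i => LoId.mono (Finset.le_sup (Finset.mem_univ i)) ?_⟩
  let φ : MvPolynomial hS.toFinset ℚ →+* ℝ :=
    (MvPolynomial.aeval (fun s : hS.toFinset => p.coeff s.1)).toRingHom
  have hφ : MvPolynomial.map φ F = p := by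
    simp only [F, map_sum, MvPolynomial.map_monomial]
    have : ∀ s : hS.toFinset, φ (MvPolynomial.X s) = p.coeff s.1 := by
      intro s; simp [φ]
    simp only [this]
    rw [Finset.sum_coe_sort hS.toFinset (fun s => MvPolynomial.monomial s (p.coeff s))]
    conv_rhs => rw [MvPolynomial.as_sum p]
    symm
    apply Finset.sum_subset
    · intro s hs
      rw [Set.Finite.mem_toFinset]
      exact (MvPolynomial.le_totalDegree hs).trans hp
    · intro s _ hs
      rw [MvPolynomial.notMem_support_iff.mp hs]; simp
  have := hN i φ bot_le
  rwa [hφ] at this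

/-- Evaluation of a polynomial at a point of Euclidean space. -/
def evE {m : ℕ} (p : MvPolynomial (Fin m) ℝ) (z : Euc m) : ℝ := MvPolynomial.eval (fun k => z k) p

theorem evE_continuous {m : ℕ} (p : MvPolynomial (Fin m) ℝ) : Continuous (evE p) := by
  unfold evE
  exact (MvPolynomial.continuous_eval p).comp (by fun_prop)

/-- All elements of the ideal are bounded by a multiple of `w` on `S`. -/
def IdO {m : ℕ} (S : Set (Euc m)) (w : Euc m → ℝ) (I : Ideal (MvPolynomial (Fin m) ℝ)) : Prop :=
  ∀ a ∈ I, ∃ C, 0 ≤ C ∧ ∀ z ∈ S, |evE a z| ≤ C * w z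

theorem IdO.mul {m : ℕ} {S : Set (Euc m)} {w w' : Euc m → ℝ}
    {I I' : Ideal (MvPolynomial (Fin m) ℝ)} (hI : IdO S w I) (hI' : IdO S w' I') :
    IdO S (fun z => w z * w' z) (I * I') := by
  intro a ha
  refine Submodule.mul_induction_on ha ?_ ?_
  · intro x hx y hy
    obtain ⟨C, hC, h⟩ := hI x hx
    obtain ⟨C', hC', h'⟩ := hI' y hy
    refine ⟨C * C', by positivity, fun z hz => ?_⟩
    have : evE (x * y) z = evE x z * evE y z := by simp [evE]
    rw [this, abs_mul]
    calc |evE x z| * |evE y z| ≤ (C * w z) * (C' * w' z) :=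
          mul_le_mul (h z hz) (h' z hz) (abs_nonneg _) ((abs_nonneg _).trans (h z hz))
      _ = _ := by ring
  · rintro x y ⟨C, hC, h⟩ ⟨C', hC', h'⟩
    refine ⟨C + C', by positivity, fun z hz => ?_⟩
    have : evE (x + y) z = evE x z + evE y z := by simp [evE]
    rw [this]
    calc |evE x z + evE y z| ≤ |evE x z| + |evE y z| := abs_add_le _ _
      _ ≤ C * (w z * w' z) + C' * (w z * w' z) := add_le_add (h z hz) (h' z hz)
      _ = _ := by ring

theorem IdO.span {m : ℕ} {S : Set (Euc m)} (hS : IsCompact S) {w : Euc m → ℝ} (hw : ∀ z, 0 ≤ w z)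
    {s : Set (MvPolynomial (Fin m) ℝ)} (h : ∀ a ∈ s, ∀ z ∈ S, |evE a z| ≤ w z) :
    IdO S w (Ideal.span s) := by
  intro a ha
  refine Submodule.span_induction (p := fun a _ => ∃ C, 0 ≤ C ∧ ∀ z ∈ S, |evE a z| ≤ C * w z)
    ?_ ?_ ?_ ?_ ha
  · intro x hx
    exact ⟨1, zero_le_one, fun z hz => by rw [one_mul]; exact h x hx z hz⟩
  · exact ⟨0, le_rfl, fun z hz => by simp [evE]⟩
  · rintro x y _ _ ⟨C, hC, h⟩ ⟨C', hC', h'⟩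
    refine ⟨C + C', by positivity, fun z hz => ?_⟩
    have : evE (x + y) z = evE x z + evE y z := by simp [evE]
    rw [this]
    calc |evE x z + evE y z| ≤ |evE x z| + |evE y z| := abs_add_le _ _
      _ ≤ C * w z + C' * w z := add_le_add (h z hz) (h' z hz)
      _ = _ := by ring
  · rintro a x _ ⟨C, hC, h⟩
    obtain ⟨M, hM⟩ := hS.exists_bound_of_continuousOn (evE_continuous a).continuousOn
    refine ⟨|M| * C, by positivity, fun z hz => ?_⟩
    have : evE (a • x) z = evE a z * evE x z := by simp [evE]
    rw [this, abs_mul, mul_assoc]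
    exact mul_le_mul ((hM z hz).trans (le_abs_self _)) (h z hz) (abs_nonneg _) (abs_nonneg _)

theorem IdO.pow {m : ℕ} {S : Set (Euc m)} (hS : IsCompact S) {w : Euc m → ℝ}
    {I : Ideal (MvPolynomial (Fin m) ℝ)} (hI : IdO S w I) (N : ℕ) :
    IdO S (fun z => w z ^ N) (I ^ N) := by
  induction N with
  | zero =>
    intro a _
    obtain ⟨M, hM⟩ := hS.exists_bound_of_continuousOn (evE_continuous a).continuousOn
    exact ⟨|M|, abs_nonneg _, fun z hz => by
      simpa using (hM z hz).trans (le_abs_self _)⟩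
  | succ N ih =>
    simp only [pow_succ]
    exact ih.mul hI

/-- The sup norm of the gradient. -/
def gradSup {m : ℕ} (p : MvPolynomial (Fin m) ℝ) (z : Euc m) : ℝ :=
  ‖fun j => evE (MvPolynomial.pderiv j p) z‖

theorem loj_sup {m N : ℕ} (hN : 2 ≤ N) (q : MvPolynomial (Fin m) ℝ) (hq : ∀ i, LoId N q i)
    (xs : Euc m) (hxs : evE q xs = 0) :
    ∃ C > 0, ∃ r > 0, ∀ z, dist z xs < r → 0 < gradSup q z →
      |evE q z| ^ (N - 1) ≤ C * gradSup q z ^ N := by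
  have hS : IsCompact (Metric.closedBall xs 1) := isCompact_closedBall xs 1
  have hG : ∀ z j, |evE (MvPolynomial.pderiv j q) z| ≤ gradSup q z := fun z j => by
    rw [← Real.norm_eq_abs]
    exact norm_le_pi_norm (fun j => evE (MvPolynomial.pderiv j q) z) j
  have hG0 : ∀ z, 0 ≤ gradSup q z := fun z => norm_nonneg _
  have hb : ∀ i, ∃ C, 0 ≤ C ∧ ∀ z ∈ Metric.closedBall xs 1,
      |evE ((q * MvPolynomial.pderiv i q) ^ N) z| ≤
        C * (|evE q z| * (gradSup q z * max |evE q z| (gradSup q z)) ^ N) := by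
    intro i
    have h1 : IdO (Metric.closedBall xs 1) (fun z => |evE q z|) (Ideal.span {q}) :=
      IdO.span hS (fun _ => abs_nonneg _) (by
        intro a ha z _
        rw [Set.mem_singleton_iff.mp ha])
    have h2 : IdO (Metric.closedBall xs 1) (gradSup q)
        (Ideal.span (Set.range fun j => MvPolynomial.pderiv j q)) :=
      IdO.span hS hG0 (by
        rintro a ⟨j, rfl⟩ z _
        exact hG z j)
    have h3 : IdO (Metric.closedBall xs 1) (fun z => max |evE q z| (gradSup q z))
        (Ideal.span {q, MvPolynomial.pderiv i q}) :=
      IdO.span hS (fun z => (abs_nonneg _).trans (le_max_left _ _)) (by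
        intro a ha z _
        rcases ha with rfl | ha
        · exact le_max_left _ _
        · rw [Set.mem_singleton_iff.mp ha]
          exact (hG z i).trans (le_max_right _ _))
    exact h1.mul ((h2.mul h3).pow hS N) _ (hq i)
  choose C hC hCb using hb
  let D := (∑ i, C i) + 1
  have hDpos : 0 < D := by
    have : 0 ≤ ∑ i, C i := Finset.sum_nonneg fun i _ => hC i
    simp only [D]; linarith
  have hCD : ∀ i, C i ≤ D := fun i => by
    have := Finset.single_le_sum (f := C) (fun i _ => hC i) (Finset.mem_univ i)
    simp only [D]; linarith
  have hcont : Tendsto (fun z => D * |evE q z|) (𝓝 xs) (𝓝 0) := by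
    have : Continuous (fun z => D * |evE q z|) := by
      have := evE_continuous q
      fun_prop
    simpa [hxs] using this.tendsto xs
  obtain ⟨r, hr, hrb⟩ := Metric.eventually_nhds_iff.mp (hcont.eventually (gt_mem_nhds zero_lt_one))
  refine ⟨D, hDpos, min r 1, by positivity, fun z hz hGz => ?_⟩
  have hz1 := hrb (hz.trans_le (min_le_left _ _))
  have hzS : z ∈ Metric.closedBall xs 1 := (hz.trans_le (min_le_right _ _)).le
  by_cases hq0 : evE q z = 0
  · rw [hq0, abs_zero, zero_pow (by omega)]
    exact mul_nonneg hDpos.le (pow_nonneg (hG0 z) _)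
  have hqpos : 0 < |evE q z| := abs_pos.mpr hq0
  have hne : Nonempty (Fin m) := by
    by_contra hne
    rw [not_nonempty_iff] at hne
    have : (fun j => evE (MvPolynomial.pderiv j q) z) = 0 := funext fun j => hne.elim j
    rw [gradSup, this, norm_zero] at hGz
    exact lt_irrefl _ hGz
  obtain ⟨i, hi⟩ := Finite.exists_max (fun j => |evE (MvPolynomial.pderiv j q) z|)
  have hiG : |evE (MvPolynomial.pderiv i q) z| = gradSup q z := by
    refine le_antisymm (hG z i) ?_
    rw [gradSup, pi_norm_le_iff_of_nonneg (abs_nonneg _)]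
    exact hi
  have h1 := hCb i z hzS
  have h2 : |evE ((q * MvPolynomial.pderiv i q) ^ N) z| = |evE q z| ^ N * gradSup q z ^ N := by
    have : evE ((q * MvPolynomial.pderiv i q) ^ N) z =
      (evE q z * evE (MvPolynomial.pderiv i q) z) ^ N := by simp [evE]
    rw [this, abs_pow, abs_mul, mul_pow, hiG]
  rw [h2] at h1
  set u := |evE q z|
  set G := gradSup q z
  have h3 : u ^ N * G ^ N ≤ (D * u * max u G ^ N) * G ^ N := by
    refine h1.trans ?_
    have : 0 ≤ u * (G * max u G) ^ N := by positivity
    calc _ ≤ D * (u * (G * max u G) ^ N) := mul_le_mul_of_nonneg_right (hCD i) this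
      _ = _ := by rw [mul_pow]; ring
  have h4 : u ^ N ≤ D * u * max u G ^ N := le_of_mul_le_mul_right h3 (by positivity)
  rcases le_total G u with h | h
  · rw [max_eq_left h] at h4
    have : D * u * u ^ N < 1 * u ^ N := mul_lt_mul_of_pos_right hz1 (by positivity)
    linarith
  · rw [max_eq_right h] at h4
    obtain ⟨k, rfl⟩ : ∃ k, N = k + 1 := ⟨N - 1, by omega⟩
    have : u ^ k * u ≤ (D * G ^ (k + 1)) * u := by
      rw [← pow_succ]; linarith
    simpa using le_of_mul_le_mul_right this hqpos

theorem evE_hasFDerivAt {m : ℕ} (p : MvPolynomial (Fin m) ℝ) (z : Euc m) :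
    HasFDerivAt (evE p)
      (∑ k, evE (MvPolynomial.pderiv k p) z • (EuclideanSpace.proj k : Euc m →L[ℝ] ℝ)) z := by
  classical
  induction p using MvPolynomial.induction_on with
  | C a =>
    have h1 : evE (MvPolynomial.C a : MvPolynomial (Fin m) ℝ) = fun _ => a := by
      funext z; simp [evE]
    rw [h1]
    simpa [evE] using hasFDerivAt_const a z
  | add p q hp hq =>
    have h1 : evE (p + q) = evE p + evE q := by funext z; simp [evE]
    rw [h1]
    refine (hp.add hq).congr_fderiv ?_
    symm
    rw [← Finset.sum_add_distrib]
    refine Finset.sum_congr rfl fun k _ => ?_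
    rw [← add_smul]; congr 1
    simp [evE]
  | mul_X p i hp =>
    have h1 : evE (p * MvPolynomial.X i) = fun z => evE p z * z i := by funext z; simp [evE]
    rw [h1]
    have hX : HasFDerivAt (fun z : Euc m => z i) (EuclideanSpace.proj i : Euc m →L[ℝ] ℝ) z :=
      (EuclideanSpace.proj i : Euc m →L[ℝ] ℝ).hasFDerivAt
    refine (hp.mul hX).congr_fderiv ?_
    symm
    have h2 : ∀ k, evE (MvPolynomial.pderiv k (p * MvPolynomial.X i)) z =
        z i * evE (MvPolynomial.pderiv k p) z + (if k = i then evE p z else 0) := by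
      intro k
      rw [MvPolynomial.pderiv_mul, MvPolynomial.pderiv_X]
      by_cases h : k = i
      · subst h; simp [evE]; ring
      · simp [evE, h, Ne.symm h]; ring
    simp only [h2, add_smul, Finset.sum_add_distrib, ite_smul, zero_smul, Finset.sum_ite_eq',
      Finset.mem_univ, if_true, Finset.smul_sum, mul_smul]
    rw [add_comm]

theorem evE_gradient {m : ℕ} (p : MvPolynomial (Fin m) ℝ) (z : Euc m) :
    gradient (evE p) z = WithLp.toLp 2 (fun k => evE (MvPolynomial.pderiv k p) z) := by
  apply HasGradientAt.gradient
  rw [hasGradientAt_iff_hasFDerivAt]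
  refine (evE_hasFDerivAt p z).congr_fderiv ?_
  ext v
  simp [PiLp.inner_apply, mul_comm]

theorem gradSup_le {m : ℕ} (p : MvPolynomial (Fin m) ℝ) (z : Euc m) :
    gradSup p z ≤ ‖gradient (evE p) z‖ := by
  rw [evE_gradient, gradSup, pi_norm_le_iff_of_nonneg (norm_nonneg _)]
  intro i
  exact PiLp.norm_apply_le (WithLp.toLp 2 (fun k => evE (MvPolynomial.pderiv k p) z)) i

theorem poly_loj (m D : ℕ) : ∃ N, 2 ≤ N ∧ ∀ p : MvPolynomial (Fin m) ℝ, p.totalDegree ≤ D →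
    ∀ xs : Euc m, ∃ C > 0, ∃ r > 0, ∀ z, dist z xs < r → gradient (evE p) z ≠ 0 →
      |evE p z - evE p xs| ^ (N - 1) ≤ C * ‖gradient (evE p) z‖ ^ N := by
  obtain ⟨N, hN⟩ := loId_uniform m D
  refine ⟨max N 2, le_max_right _ _, fun p hp xs => ?_⟩
  let q := p - MvPolynomial.C (evE p xs)
  have hq : ∀ z, evE q z = evE p z - evE p xs := fun z => by simp [q, evE]
  have hd : ∀ j, MvPolynomial.pderiv j q = MvPolynomial.pderiv j p := fun j => by simp [q]
  have hs : ∀ z, gradSup q z = gradSup p z := fun z => by simp [gradSup, hd]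
  obtain ⟨C, hC, r, hr, h⟩ := loj_sup (le_max_right N 2) q
    (fun i => LoId.mono (le_max_left _ _) (hN q ((MvPolynomial.totalDegree_sub_C_le _ _).trans hp) i))
    xs (by rw [hq, sub_self])
  refine ⟨C, hC, r, hr, fun z hz hg => ?_⟩
  have hpos : 0 < gradSup q z := by
    refine lt_of_le_of_ne (norm_nonneg _) fun h0 => hg ?_
    rw [hs, gradSup] at h0
    rw [evE_gradient, norm_eq_zero.mp h0.symm]
    rfl
  have := h z hz hpos
  rw [hq, hs] at this
  refine this.trans (mul_le_mul_of_nonneg_left ?_ hC.le)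
  exact pow_le_pow_left₀ (norm_nonneg _) (gradSup_le p z) _

theorem kappa_pos {m : ℕ} (hm : 1 ≤ m) (δ : Fin (m + 1) → ℝ) (hδ : Function.Injective δ) :
    0 < kappa δ := by
  unfold kappa
  set S := {r : ℝ | ∃ i j : Fin (m + 1), i ≠ j ∧ r = |δ i - δ j|} with hS
  have hfin : S.Finite := by
    refine (Set.finite_range (fun ij : Fin (m + 1) × Fin (m + 1) => |δ ij.1 - δ ij.2|)).subset ?_
    rintro r ⟨i, j, _, rfl⟩
    exact ⟨(i, j), rfl⟩
  have hne : S.Nonempty := by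
    refine ⟨_, 0, Fin.last m, ?_, rfl⟩
    intro h
    have := congrArg Fin.val h
    simp at this
    omega
  obtain ⟨i, j, hij, h⟩ := hne.csInf_mem hfin
  rw [h]
  have : 0 < |δ i - δ j| := abs_pos.mpr (sub_ne_zero.mpr fun h => hij (hδ h))
  positivity

theorem minsp_le {m : ℕ} (A : Euc m →L[ℝ] Euc m) (v : Euc m) (hv : ‖v‖ = 1) :
    minsp A ≤ ‖A v‖ := by
  refine csInf_le ⟨0, ?_⟩ ⟨v, hv, rfl⟩
  rintro r ⟨e, _, rfl⟩
  exact norm_nonneg _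

theorem dir_sums {m : ℕ} (f : Euc m → ℝ) (A : Euc m →L[ℝ] Euc m) (e : Fin m → Euc m)
    (he : Orthonormal ℝ e) (x : Euc m) :
    ⟪dirW f A e x, gradient f x⟫ = ∑ i, ⟪gradient f x, e i⟫ ^ 2 / ‖A (e i)‖ ∧
    ‖dirW f A e x‖ ^ 2 = ∑ i, (⟪gradient f x, e i⟫ / ‖A (e i)‖) ^ 2 ∧
    ‖gradient f x‖ ^ 2 = ∑ i, ⟪gradient f x, e i⟫ ^ 2 := by
  refine ⟨?_, ?_, ?_⟩
  · unfold dirW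
    rw [sum_inner]
    refine Finset.sum_congr rfl fun i _ => ?_
    rw [inner_smul_left, real_inner_comm]
    simp only [conj_trivial]
    ring
  · unfold dirW
    rw [← real_inner_self_eq_norm_sq, he.inner_sum]
    refine Finset.sum_congr rfl fun i _ => ?_
    simp only [conj_trivial]
    ring
  · have hspan : ⊤ ≤ Submodule.span ℝ (Set.range e) := by
      rw [he.linearIndependent.span_eq_top_of_card_eq_finrank' (by simp)]
    let b := OrthonormalBasis.mk he hspan
    rw [← b.sum_sq_norm_inner_left]
    refine Finset.sum_congr rfl fun i _ => ?_
    simp [b]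

theorem dir_bounds {m : ℕ} (f : Euc m → ℝ) (A : Euc m →L[ℝ] Euc m) (e : Fin m → Euc m)
    (he : Orthonormal ℝ e) (x : Euc m) (l L : ℝ) (hl : 0 < l) (hL : 0 < L)
    (hlA : ∀ i, l ≤ ‖A (e i)‖) (hLA : ∀ i, ‖A (e i)‖ ≤ L) :
    l * ‖dirW f A e x‖ ^ 2 ≤ ⟪dirW f A e x, gradient f x⟫ ∧
    ‖gradient f x‖ ^ 2 / L ≤ ⟪dirW f A e x, gradient f x⟫ := by
  obtain ⟨h1, h2, h3⟩ := dir_sums f A e he x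
  rw [h1, h2, h3]
  constructor
  · rw [Finset.mul_sum]
    refine Finset.sum_le_sum fun i _ => ?_
    have hp : 0 < ‖A (e i)‖ := hl.trans_le (hlA i)
    rw [div_pow, ← mul_div_assoc, div_le_div_iff₀ (by positivity) hp]
    have := mul_le_mul_of_nonneg_right (hlA i)
      (show 0 ≤ ⟪gradient f x, e i⟫ ^ 2 * ‖A (e i)‖ by positivity)
    nlinarith
  · rw [Finset.sum_div]
    refine Finset.sum_le_sum fun i _ => ?_
    have hp : 0 < ‖A (e i)‖ := hl.trans_le (hlA i)
    exact div_le_div_of_nonneg_left (sq_nonneg _) hp (hLA i)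

theorem hat_bounds {m : ℕ} (f : Euc m → ℝ) (A : Euc m →L[ℝ] Euc m) (e : Fin m → Euc m)
    (he : Orthonormal ℝ e) (x : Euc m) (l L : ℝ) (hl : 0 < l) (hL : 0 < L)
    (hlA : ∀ i, l ≤ ‖A (e i)‖) (hLA : ∀ i, ‖A (e i)‖ ≤ L) :
    ‖hatW f A e x‖ ≤ 1 ∧
    Real.sqrt (l / L) * ‖gradient f x‖ * ‖hatW f A e x‖ ≤ ⟪hatW f A e x, gradient f x⟫ ∧
    ‖gradient f x‖ ^ 2 / L / max 1 (‖gradient f x‖ / l) ≤ ⟪hatW f A e x, gradient f x⟫ := by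
  obtain ⟨h1, h2⟩ := dir_bounds f A e he x l L hl hL hlA hLA
  unfold hatW
  set w := dirW f A e x
  set g := gradient f x
  have hM : 0 < max 1 ‖w‖ := lt_of_lt_of_le one_pos (le_max_left _ _)
  rw [norm_smul, inner_smul_left, norm_inv, Real.norm_of_nonneg hM.le]
  simp only [conj_trivial]
  refine ⟨?_, ?_, ?_⟩
  · rw [inv_mul_le_iff₀ hM, mul_one]; exact le_max_right _ _
  · have h3 : Real.sqrt (l / L) * ‖g‖ * ‖w‖ ≤ ⟪w, g⟫ := by
      have hw0 : 0 ≤ ⟪w, g⟫ := le_trans (by positivity) h1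
      refine le_of_sq_le_sq ?_ hw0
      rw [mul_pow, mul_pow, Real.sq_sqrt (by positivity)]
      calc l / L * ‖g‖ ^ 2 * ‖w‖ ^ 2 = (l * ‖w‖ ^ 2) * (‖g‖ ^ 2 / L) := by ring
        _ ≤ ⟪w, g⟫ * ⟪w, g⟫ := mul_le_mul h1 h2 (by positivity) hw0
        _ = _ := by ring
    have := mul_le_mul_of_nonneg_left h3 (inv_nonneg.mpr hM.le)
    linarith
  · have hwg : ‖w‖ ≤ ‖g‖ / l := by
      rw [le_div_iff₀ hl]
      by_cases hw : ‖w‖ = 0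
      · rw [hw, zero_mul]; exact norm_nonneg _
      have hwpos : 0 < ‖w‖ := lt_of_le_of_ne (norm_nonneg _) (Ne.symm hw)
      have := h1.trans (real_inner_le_norm w g)
      refine le_of_mul_le_mul_left ?_ hwpos
      linarith
    rw [div_eq_mul_inv, mul_comm]
    refine mul_le_mul ?_ h2 (by positivity) (inv_nonneg.mpr hM.le)
    exact inv_anti₀ hM (max_le_max le_rfl hwg)

/-- Abstract trapping lemma. -/
theorem trap {E : Type*} [PseudoMetricSpace E] (x : ℕ → E) (xs : E) (v : ℕ → ℝ) (C r : ℝ)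
    (hC : 0 < C) (hr : 0 < r) (hv0 : ∀ n, 0 ≤ v n) (hv : Tendsto v atTop (𝓝 0))
    (φ : ℕ → ℕ) (hφ : Tendsto φ atTop atTop) (hx : Tendsto (x ∘ φ) atTop (𝓝 xs))
    (h : ∀ n, dist (x n) xs < r → dist (x n) (x (n + 1)) ≤ C * (v n - v (n + 1))) :
    Tendsto x atTop (𝓝 xs) := by
  rw [Metric.tendsto_atTop]
  intro ε0 hε0
  set ε := min ε0 r with hε
  have hεpos : 0 < ε := lt_min hε0 hr
  have e1 : ∀ᶠ k in atTop, dist (x (φ k)) xs < ε / 2 :=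
    (Metric.tendsto_nhds.mp hx) (ε / 2) (by positivity)
  have e2 : ∀ᶠ k in atTop, v (φ k) < ε / (2 * C) :=
    (hv.comp hφ).eventually (gt_mem_nhds (by positivity))
  obtain ⟨k, hk1, hk2⟩ := (e1.and e2).exists
  refine ⟨φ k, fun n hn => lt_of_lt_of_le ?_ (min_le_left ε0 r)⟩
  have hk3 : C * v (φ k) < ε / 2 := by
    rw [lt_div_iff₀ (by positivity)] at hk2
    linarith
  have key : ∀ n, φ k ≤ n → dist (x (φ k)) (x n) ≤ C * (v (φ k) - v n) := by
    intro n hn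
    induction n, hn using Nat.le_induction with
    | base => simp
    | succ n hn ih =>
      have hb : dist (x n) xs < r := by
        have h1 := dist_triangle_left (x n) xs (x (φ k))
        have h2 := mul_nonneg hC.le (hv0 n)
        have h3 : ε ≤ r := min_le_right _ _
        linarith
      have h1 := h n hb
      have h2 := dist_triangle (x (φ k)) (x n) (x (n + 1))
      linarith
  have h1 := dist_triangle_left (x n) xs (x (φ k))
  have h2 := mul_nonneg hC.le (hv0 n)
  have h3 := key n hn
  linarith

theorem rpow_concave (u u' β : ℝ) (hu : 0 < u) (hu' : 0 ≤ u') (hβ0 : 0 ≤ β) (hβ1 : β ≤ 1) :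
    β * u ^ (β - 1) * (u - u') ≤ u ^ β - u' ^ β := by
  have h1 : (1 + (u' / u - 1)) ^ β ≤ 1 + β * (u' / u - 1) :=
    rpow_one_add_le_one_add_mul_self
      (by have : 0 ≤ u' / u := by positivity
          linarith) hβ0 hβ1
  have h2 : 1 + (u' / u - 1) = u' / u := by ring
  rw [h2, Real.div_rpow hu' hu.le, div_le_iff₀ (by positivity)] at h1
  rw [Real.rpow_sub_one hu.ne']
  have h3 : (1 + β * (u' / u - 1)) * u ^ β = u ^ β - β * (u ^ β / u) * (u - u') := by
    field_simp
    ring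
  linarith

theorem step_real (N : ℕ) (hN : 2 ≤ N) (σ C c u u' G s : ℝ) (hσ : 0 < σ)
    (hσN : σ * (N - 1 : ℕ) < N) (hC : 0 < C) (hc : 0 < c) (hu : 0 < u) (hu' : 0 ≤ u')
    (hG : 0 < G) (hs : 0 ≤ s) (h1 : u ^ (N - 1) ≤ C * G ^ N) (h2 : c * G ^ σ * s ≤ u - u') :
    s ≤ (C ^ (σ / N) / (c * (1 - σ * (N - 1 : ℕ) / N))) *
      (u ^ (1 - σ * (N - 1 : ℕ) / N) - u' ^ (1 - σ * (N - 1 : ℕ) / N)) := by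
  have hNpos : (0 : ℝ) < N := by exact_mod_cast (by omega : 0 < N)
  set α : ℝ := σ * (N - 1 : ℕ) / N with hα
  have hα0 : 0 ≤ α := by positivity
  have hα1 : α < 1 := by rw [hα, div_lt_one hNpos]; exact hσN
  have h3 : u ^ α ≤ C ^ (σ / N) * G ^ σ := by
    have := Real.rpow_le_rpow (by positivity) h1 (show 0 ≤ σ / N by positivity)
    rw [Real.mul_rpow hC.le (by positivity), ← Real.rpow_natCast, ← Real.rpow_mul hu.le,
      ← Real.rpow_natCast, ← Real.rpow_mul hG.le] at this
    have e1 : ((N - 1 : ℕ) : ℝ) * (σ / N) = α := by rw [hα]; ring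
    have e2 : (N : ℝ) * (σ / N) = σ := by field_simp
    rwa [e1, e2] at this
  have h4 := rpow_concave u u' (1 - α) hu hu' (by linarith) (by linarith)
  have e3 : (1 - α - 1) = -α := by ring
  rw [e3, Real.rpow_neg hu.le] at h4
  have hβ : 0 < 1 - α := by linarith
  have hua : 0 < u ^ α := by positivity
  rw [div_mul_eq_mul_div, le_div_iff₀ (by positivity)]
  have h5 : c * u ^ α * s ≤ C ^ (σ / N) * (u - u') := by
    calc c * u ^ α * s ≤ c * (C ^ (σ / N) * G ^ σ) * s := by gcongr
      _ = C ^ (σ / N) * (c * G ^ σ * s) := by ring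
      _ ≤ _ := by gcongr
  have h6 : s * (c * (1 - α)) = (1 - α) * (u ^ α)⁻¹ * (c * u ^ α * s) := by
    field_simp
  rw [h6]
  calc (1 - α) * (u ^ α)⁻¹ * (c * u ^ α * s) ≤ (1 - α) * (u ^ α)⁻¹ * (C ^ (σ / N) * (u - u')) := by
        gcongr
    _ = C ^ (σ / N) * ((1 - α) * (u ^ α)⁻¹ * (u - u')) := by ring
    _ ≤ _ := by gcongr

theorem step_bounds {m : ℕ} (hm : 1 ≤ m) (F : Euc m → ℝ) (hgc : Continuous (gradient F))
    (hHc : Continuous (hessOp F)) (δ : Fin (m + 1) → ℝ) (τ : ℝ) (hτ : 0 < τ) (xs : Euc m) :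
    ∃ L > 0, ∀ x, dist x xs ≤ 1 → ∀ j, ∀ v : Euc m, ‖v‖ = 1 → ‖Aop F (δ j) τ x v‖ ≤ L := by
  have hS : IsCompact (Metric.closedBall xs 1) := isCompact_closedBall xs 1
  obtain ⟨M1, hM1⟩ := hS.exists_bound_of_continuousOn hgc.continuousOn
  obtain ⟨M2, hM2⟩ := hS.exists_bound_of_continuousOn hHc.continuousOn
  have hxs : xs ∈ Metric.closedBall xs 1 := by simp
  have hM1' : 0 ≤ M1 := (norm_nonneg _).trans (hM1 xs hxs)
  have hM2' : 0 ≤ M2 := (norm_nonneg _).trans (hM2 xs hxs)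
  refine ⟨M2 + (∑ j, |δ j|) * M1 ^ τ + 1, by positivity, fun x hx j v hv => ?_⟩
  have h1 : ‖hessOp F x v‖ ≤ M2 := by
    have := (hessOp F x).le_opNorm v
    rw [hv, mul_one] at this
    exact this.trans (hM2 x hx)
  have h2 : ‖gradient F x‖ ^ τ ≤ M1 ^ τ := Real.rpow_le_rpow (norm_nonneg _) (hM1 x hx) hτ.le
  have h3 : |δ j| ≤ ∑ j, |δ j| :=
    Finset.single_le_sum (f := fun j => |δ j|) (fun _ _ => abs_nonneg _) (Finset.mem_univ j)
  have h4 : ‖(δ j * ‖gradient F x‖ ^ τ) • v‖ ≤ (∑ j, |δ j|) * M1 ^ τ := by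
    rw [norm_smul, hv, mul_one, Real.norm_eq_abs, abs_mul,
      abs_of_nonneg (Real.rpow_nonneg (norm_nonneg _) _)]
    exact mul_le_mul h3 h2 (by positivity) (by positivity)
  have h5 : Aop F (δ j) τ x v = hessOp F x v + (δ j * ‖gradient F x‖ ^ τ) • v := by
    simp [Aop]
  rw [h5]
  have := norm_add_le (hessOp F x v) ((δ j * ‖gradient F x‖ ^ τ) • v)
  linarith

theorem armijo_local {m : ℕ} (F : Euc m → ℝ) (hFd : Differentiable ℝ F)
    (hgc : Continuous (gradient F)) (xs : Euc m) (c : ℝ) (hc : 0 < c) :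
    ∃ r > 0, ∀ x, dist x xs < r → ∀ v : Euc m, ‖v‖ ≤ 1 → c ≤ ⟪v, gradient F x⟫ →
      ∀ γ, 0 ≤ γ → γ ≤ r → armijo F x v γ := by
  obtain ⟨ρ, hρ, hb⟩ := Metric.continuousAt_iff.mp (hgc.continuousAt (x := xs)) (c / 3) (by positivity)
  refine ⟨ρ / 2, by positivity, fun x hx v hv hcv γ hγ0 hγ => ?_⟩
  have hxb : x ∈ Metric.ball xs ρ := by rw [Metric.mem_ball]; linarith
  have hn : ‖γ • v‖ ≤ γ := by
    rw [norm_smul, Real.norm_of_nonneg hγ0]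
    exact mul_le_of_le_one_right hγ0 hv
  have hyb : x - γ • v ∈ Metric.ball xs ρ := by
    rw [Metric.mem_ball]
    have := dist_triangle (x - γ • v) x xs
    have h2 : dist (x - γ • v) x = ‖γ • v‖ := by rw [dist_eq_norm]; simp
    linarith
  have key := (convex_ball xs ρ).norm_image_sub_le_of_norm_hasFDerivWithin_le' (𝕜 := ℝ)
    (f := F) (f' := fderiv ℝ F) (φ := fderiv ℝ F x) (C := 2 * c / 3)
    (fun y _ => (hFd y).hasFDerivAt.hasFDerivWithinAt) (by
      intro y hy
      rw [← toDual_gradient, ← toDual_gradient, ← map_sub, LinearIsometryEquiv.norm_map,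
        ← dist_eq_norm]
      have h1 := hb hy
      have h2 := hb hxb
      have h3 := dist_triangle_right (gradient F y) (gradient F x) (gradient F xs)
      linarith) hxb hyb
  have e1 : x - γ • v - x = -(γ • v) := by abel
  have e2 : fderiv ℝ F x (-(γ • v)) = -(γ * ⟪v, gradient F x⟫) := by
    rw [← toDual_gradient, InnerProductSpace.toDual_apply_apply, inner_neg_right, inner_smul_right,
      real_inner_comm]
  rw [e1, e2, norm_neg, Real.norm_eq_abs] at key
  unfold armijo
  have h1 := (abs_le.mp key).2
  have h2 : 2 * c / 3 * ‖γ • v‖ ≤ 2 * c / 3 * γ := by gcongr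
  have h3 : c * γ ≤ γ * ⟪v, gradient F x⟫ := by
    rw [mul_comm]; gcongr
  linarith

theorem step_mono {m : ℕ} (F : Euc m → ℝ) (δ : Fin (m + 1) → ℝ) (τ γ0 : ℝ) (hγ0 : 0 < γ0)
    (e : Fin m → Euc m) (he : Orthonormal ℝ e) (j : Fin (m + 1)) (x x' : Euc m)
    (h : IsQNGStep δ τ γ0 F e j x x') : F x' ≤ F x := by
  by_cases hg : gradient F x = 0
  · rw [h.1 hg]
  obtain ⟨_, _, p, ha, _, rfl⟩ := h.2 hg
  unfold armijo at ha
  have h0 : 0 ≤ ⟪hatW F (Aop F (δ j) τ x) e x, gradient F x⟫ := by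
    unfold hatW
    rw [inner_smul_left, (dir_sums F _ e he x).1]
    simp only [conj_trivial]
    refine mul_nonneg (inv_nonneg.mpr (zero_le_one.trans (le_max_left _ _))) ?_
    exact Finset.sum_nonneg fun i _ => by positivity
  have : 0 ≤ γ0 * (1 / 3) ^ p * ⟪hatW F (Aop F (δ j) τ x) e x, gradient F x⟫ := by positivity
  linarith

theorem qng_step_angle {m : ℕ} (hm : 1 ≤ m) (F : Euc m → ℝ) (hgc : Continuous (gradient F))
    (hHc : Continuous (hessOp F)) (δ : Fin (m + 1) → ℝ) (hδ : Function.Injective δ)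
    (τ γ0 : ℝ) (hτ : 0 < τ) (hγ0 : 0 < γ0) (xs : Euc m) :
    ∃ c > 0, ∀ x x' e j, dist x xs ≤ 1 → Orthonormal ℝ e → IsQNGStep δ τ γ0 F e j x x' →
      gradient F x ≠ 0 → c * ‖gradient F x‖ ^ (1 + τ / 2) * dist x x' ≤ F x - F x' := by
  obtain ⟨L, hL, hLb⟩ := step_bounds hm F hgc hHc δ τ hτ xs
  have hκ := kappa_pos hm δ hδ
  refine ⟨Real.sqrt (kappa δ / L) / 3, by positivity, fun x x' e j hx he hst hg => ?_⟩
  obtain ⟨hgood, _, p, ha, _, rfl⟩ := hst.2 hg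
  have hgpos : 0 < ‖gradient F x‖ := norm_pos_iff.mpr hg
  obtain ⟨_, h2, _⟩ := hat_bounds F (Aop F (δ j) τ x) e he x (kappa δ * ‖gradient F x‖ ^ τ) L
    (by positivity) hL (fun i => hgood.trans (minsp_le _ _ (he.1 i))) (fun i => hLb x hx j _ (he.1 i))
  set v := hatW F (Aop F (δ j) τ x) e x
  set γ := γ0 * (1 / 3) ^ p
  have hγ : 0 < γ := by positivity
  have e1 : dist x (x - γ • v) = γ * ‖v‖ := by
    rw [dist_eq_norm]
    simp [norm_smul, abs_of_pos hγ]
  have e2 : Real.sqrt (kappa δ * ‖gradient F x‖ ^ τ / L) * ‖gradient F x‖ =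
      Real.sqrt (kappa δ / L) * ‖gradient F x‖ ^ (1 + τ / 2) := by
    have : kappa δ * ‖gradient F x‖ ^ τ / L = kappa δ / L * ‖gradient F x‖ ^ τ := by ring
    rw [this, Real.sqrt_mul (by positivity), Real.sqrt_eq_rpow (‖gradient F x‖ ^ τ),
      ← Real.rpow_mul hgpos.le, Real.rpow_add hgpos, Real.rpow_one]
    have : τ * (1 / 2) = τ / 2 := by ring
    rw [this]; ring
  rw [e2] at h2
  unfold armijo at ha
  rw [e1]
  have := mul_le_mul_of_nonneg_left h2 hγ.le
  linarith

theorem qng_step_drop {m : ℕ} (hm : 1 ≤ m) (F : Euc m → ℝ) (hFd : Differentiable ℝ F)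
    (hgc : Continuous (gradient F))
    (hHc : Continuous (hessOp F)) (δ : Fin (m + 1) → ℝ) (hδ : Function.Injective δ)
    (τ γ0 : ℝ) (hτ : 0 < τ) (hγ0 : 0 < γ0) (xs : Euc m) (hxs : gradient F xs ≠ 0) :
    ∃ c > 0, ∃ r > 0, ∀ x x' e j, dist x xs < r → Orthonormal ℝ e → IsQNGStep δ τ γ0 F e j x x' →
      c ≤ F x - F x' := by
  obtain ⟨L, hL, hLb⟩ := step_bounds hm F hgc hHc δ τ hτ xs
  have hκ := kappa_pos hm δ hδ
  have hGs : 0 < ‖gradient F xs‖ := norm_pos_iff.mpr hxs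
  set G := ‖gradient F xs‖ with hG
  have ev1 : ∀ᶠ x in 𝓝 xs, G / 2 < ‖gradient F x‖ :=
    hgc.norm.continuousAt.eventually (lt_mem_nhds (by linarith))
  have ev2 : ∀ᶠ x in 𝓝 xs, ‖gradient F x‖ < 2 * G :=
    hgc.norm.continuousAt.eventually (gt_mem_nhds (by linarith))
  obtain ⟨r1, hr1, hb1⟩ := Metric.eventually_nhds_iff.mp (ev1.and ev2)
  set l := kappa δ * (G / 2) ^ τ with hl
  have hlpos : 0 < l := by positivity
  set c0 := (G / 2) ^ 2 / L / max 1 (2 * G / l) with hc0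
  have hMp : 0 < max 1 (2 * G / l) := lt_of_lt_of_le one_pos (le_max_left _ _)
  have hc0pos : 0 < c0 := by positivity
  obtain ⟨r2, hr2, hb2⟩ := armijo_local F hFd hgc xs c0 hc0pos
  set γm := min γ0 (r2 / 3) with hγm
  have hγmpos : 0 < γm := by positivity
  refine ⟨γm * c0 / 3, by positivity, min 1 (min r1 r2), by positivity,
    fun x x' e j hx he hst => ?_⟩
  have hx1 : dist x xs ≤ 1 := (hx.trans_le (min_le_left _ _)).le
  have hx2 : dist x xs < r1 := hx.trans_le ((min_le_right _ _).trans (min_le_left _ _))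
  have hx3 : dist x xs < r2 := hx.trans_le ((min_le_right _ _).trans (min_le_right _ _))
  obtain ⟨hg1, hg2⟩ := hb1 hx2
  have hgpos : 0 < ‖gradient F x‖ := by linarith
  have hg : gradient F x ≠ 0 := norm_pos_iff.mp hgpos
  obtain ⟨hgood, _, p, ha, hp, rfl⟩ := hst.2 hg
  have hlx : l ≤ kappa δ * ‖gradient F x‖ ^ τ := by
    rw [hl]; gcongr
  obtain ⟨h1, _, h2⟩ := hat_bounds F (Aop F (δ j) τ x) e he x l L
    hlpos hL (fun i => hlx.trans (hgood.trans (minsp_le _ _ (he.1 i))))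
    (fun i => hLb x hx1 j _ (he.1 i))
  set v := hatW F (Aop F (δ j) τ x) e x
  have h3 : c0 ≤ ⟪v, gradient F x⟫ := by
    refine le_trans ?_ h2
    rw [hc0]
    gcongr
  have h4 : γm ≤ γ0 * (1 / 3) ^ p := by
    rcases Nat.eq_zero_or_pos p with rfl | hp0
    · simp [hγm]
    · by_contra hlt
      push Not at hlt
      obtain ⟨k, rfl⟩ : ∃ k, p = k + 1 := ⟨p - 1, by omega⟩
      refine hp k (by omega) (hb2 x hx3 v h1 h3 _ (by positivity) ?_)
      have := hlt.trans_le (min_le_right γ0 (r2 / 3))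
      rw [pow_succ] at this
      linarith
  unfold armijo at ha
  have h5 : γm * c0 ≤ γ0 * (1 / 3) ^ p * ⟪v, gradient F x⟫ := by gcongr
  linarith

theorem qng_main {m : ℕ} (hm : 1 ≤ m) (F : Euc m → ℝ) (hFd : Differentiable ℝ F)
    (hgc : Continuous (gradient F)) (hHc : Continuous (hessOp F)) (hF0 : ∀ z, 0 ≤ F z)
    (N : ℕ) (hN : 2 ≤ N)
    (hloj : ∀ xs : Euc m, ∃ C > 0, ∃ r > 0, ∀ z, dist z xs < r → gradient F z ≠ 0 →
      |F z - F xs| ^ (N - 1) ≤ C * ‖gradient F z‖ ^ N)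
    (δ : Fin (m + 1) → ℝ) (hδ : Function.Injective δ)
    (τ γ0 : ℝ) (hτ : 0 < τ) (hτN : (1 + τ / 2) * (N - 1 : ℕ) < N) (hγ0 : 0 < γ0)
    (e : ℕ → Fin m → Euc m) (j : ℕ → Fin (m + 1)) (x : ℕ → Euc m)
    (h : IsQNGSeq δ τ γ0 F e j x) :
    Xor' (Tendsto (fun n => ‖x n‖) atTop atTop)
      (∃ xinf : Euc m, gradient F xinf = 0 ∧ Tendsto x atTop (𝓝 xinf)) := by
  by_cases hinf : Tendsto (fun n => ‖x n‖) atTop atTop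
  · left
    refine ⟨hinf, ?_⟩
    rintro ⟨xinf, _, hx⟩
    exact not_tendsto_nhds_of_tendsto_atTop hinf _ hx.norm
  right
  refine ⟨?_, hinf⟩
  rw [tendsto_atTop] at hinf
  push Not at hinf
  obtain ⟨R, hR⟩ := hinf
  have hfreq : ∃ᶠ n in atTop, x n ∈ Metric.closedBall (0 : Euc m) R := by
    refine hR.mono fun n hn => ?_
    simpa using hn.le
  obtain ⟨xs, _, φ, hφ, hlim⟩ := tendsto_subseq_of_frequently_bounded
    Metric.isBounded_closedBall hfreq
  have hFc : Continuous F := hFd.continuous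
  have hanti : Antitone (fun n => F (x n)) := antitone_nat_of_succ_le fun n =>
    step_mono F δ τ γ0 hγ0 (e n) (h n).1 (j n) _ _ (h n).2
  have hbdd : BddBelow (Set.range fun n => F (x n)) := ⟨0, by rintro _ ⟨n, rfl⟩; exact hF0 _⟩
  have hconv := tendsto_atTop_ciInf hanti hbdd
  have hsub : Tendsto (fun k => F (x (φ k))) atTop (𝓝 (F xs)) := (hFc.tendsto xs).comp hlim
  have hval := tendsto_nhds_unique hsub (hconv.comp hφ.tendsto_atTop)
  rw [← hval] at hconv
  have hge : ∀ n, F xs ≤ F (x n) := fun n => hanti.le_of_tendsto hconv n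
  have hcrit : gradient F xs = 0 := by
    by_contra hne
    obtain ⟨c, hc, r, hr, hdrop⟩ := qng_step_drop hm F hFd hgc hHc δ hδ τ γ0 hτ hγ0 xs hne
    have hdiff : Tendsto (fun n => F (x n) - F (x (n + 1))) atTop (𝓝 0) := by
      simpa using hconv.sub (hconv.comp (tendsto_add_atTop_nat 1))
    have ev1 : ∀ᶠ k in atTop, F (x (φ k)) - F (x (φ k + 1)) < c :=
      (hdiff.comp hφ.tendsto_atTop).eventually (gt_mem_nhds hc)
    have ev2 : ∀ᶠ k in atTop, dist (x (φ k)) xs < r := (Metric.tendsto_nhds.mp hlim) r hr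
    obtain ⟨k, hk1, hk2⟩ := (ev1.and ev2).exists
    exact absurd (hdrop _ _ _ _ hk2 (h (φ k)).1 (h (φ k)).2) (not_le.mpr hk1)
  refine ⟨xs, hcrit, ?_⟩
  obtain ⟨C, hC, r, hr, hl⟩ := hloj xs
  obtain ⟨c, hc, hang⟩ := qng_step_angle hm F hgc hHc δ hδ τ γ0 hτ hγ0 xs
  have hNpos : (0 : ℝ) < N := by exact_mod_cast (by omega : 0 < N)
  set α : ℝ := (1 + τ / 2) * (N - 1 : ℕ) / N with hα
  have hα1 : α < 1 := by rw [hα, div_lt_one hNpos]; exact hτN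
  have hβ : 0 < 1 - α := by linarith
  have hu : Tendsto (fun n => F (x n) - F xs) atTop (𝓝 0) := by
    simpa using hconv.sub_const (F xs)
  refine trap x xs (fun n => (F (x n) - F xs) ^ (1 - α))
    (C ^ ((1 + τ / 2) / N) / (c * (1 - α))) (min 1 r) (by positivity) (by positivity)
    (fun n => Real.rpow_nonneg (sub_nonneg.mpr (hge n)) _) ?_ φ hφ.tendsto_atTop hlim ?_
  · have := hu.rpow_const (p := 1 - α) (Or.inr hβ.le)
    rwa [Real.zero_rpow hβ.ne'] at this
  intro n hn
  by_cases hg : gradient F (x n) = 0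
  · rw [(h n).2.1 hg]; simp
  have hgpos : 0 < ‖gradient F (x n)‖ := norm_pos_iff.mpr hg
  have h1 := hl (x n) (hn.trans_le (min_le_right _ _)) hg
  have h2 := hang _ _ _ _ (hn.trans_le (min_le_left _ _)).le (h n).1 (h n).2 hg
  rcases (hge n).eq_or_lt with heq | hlt
  · have h3 := hge (n + 1)
    have h4 : F (x (n + 1)) ≤ F (x n) := hanti (Nat.le_succ n)
    have h5 : F (x (n + 1)) = F (x n) := by linarith
    rw [h5, sub_self] at h2
    have h6 : dist (x n) (x (n + 1)) ≤ 0 := by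
      have : 0 < c * ‖gradient F (x n)‖ ^ (1 + τ / 2) := by positivity
      by_contra hcon
      push Not at hcon
      have := mul_pos this hcon
      linarith
    simp only [h5, sub_self, mul_zero]
    exact h6
  · have hupos : 0 < F (x n) - F xs := sub_pos.mpr hlt
    rw [abs_of_pos hupos] at h1
    exact step_real N hN (1 + τ / 2) C c _ _ _ _ (by positivity) hτN hC hc hupos
      (sub_nonneg.mpr (hge (n + 1))) hgpos dist_nonneg h1 (by linarith)

theorem evE_contDiff {m : ℕ} (p : MvPolynomial (Fin m) ℝ) (n : ℕ) : ContDiff ℝ n (evE p) := by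
  induction p using MvPolynomial.induction_on with
  | C a =>
    have h1 : evE (MvPolynomial.C a : MvPolynomial (Fin m) ℝ) = fun _ => a := by
      funext z; simp [evE]
    rw [h1]; exact contDiff_const
  | add p q hp hq =>
    have h1 : evE (p + q) = fun z => evE p z + evE q z := by funext z; simp [evE]
    rw [h1]; exact hp.add hq
  | mul_X p i hp =>
    have h1 : evE (p * MvPolynomial.X i) = fun z => evE p z * z i := by funext z; simp [evE]
    rw [h1]
    exact hp.mul (EuclideanSpace.proj i : Euc m →L[ℝ] ℝ).contDiff

theorem evE_grad_contDiff {m : ℕ} (p : MvPolynomial (Fin m) ℝ) :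
    ContDiff ℝ 1 (gradient (evE p)) := by
  rw [contDiff_euclidean]
  intro k
  have : (fun z => gradient (evE p) z k) = evE (MvPolynomial.pderiv k p) := by
    funext z; rw [evE_gradient]
  rw [this]
  exact_mod_cast evE_contDiff _ 1


/-- (Systems of polynomial equations.) For every `m ≥ 1` and degree bound `d ≥ 1` there is
`τ₀ ∈ (0,1)`, depending only on `m` and `d`, such that for all real polynomials
`P_1, …, P_N` in `m` variables of degree at most `d`, with `f = P_1² + ⋯ + P_N²`, and any
sequence generated by New Q-Newton's method Backtracking G applied to `f` with `0 < τ ≤ τ₀`,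
exactly one of the following holds: `‖x_n‖ → ∞`, or `{x_n}` converges to a critical point
of `f`. -/
theorem stmt13 :
    ∀ m : ℕ, 1 ≤ m → ∀ d : ℕ, 1 ≤ d →
    ∃ τ0 : ℝ, 0 < τ0 ∧ τ0 < 1 ∧
      ∀ (N : ℕ) (P : Fin N → MvPolynomial (Fin m) ℝ),
        (∀ i : Fin N, (P i).totalDegree ≤ d) →
        ∀ (δ : Fin (m + 1) → ℝ), Function.Injective δ →
        ∀ τ γ0 : ℝ, 0 < τ → τ ≤ τ0 → 0 < γ0 → γ0 < 1 →
        ∀ (e : ℕ → Fin m → Euc m) (j : ℕ → Fin (m + 1)) (x : ℕ → Euc m),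
          IsQNGSeq δ τ γ0
            (fun z : Euc m => ∑ i : Fin N, (MvPolynomial.eval (fun k => z k) (P i)) ^ 2)
            e j x →
          Xor' (Tendsto (fun n => ‖x n‖) atTop atTop)
            (∃ xinf : Euc m,
              gradient
                (fun z : Euc m => ∑ i : Fin N, (MvPolynomial.eval (fun k => z k) (P i)) ^ 2)
                xinf = 0 ∧
              Tendsto x atTop (𝓝 xinf)) := by
  intro m hm d _
  obtain ⟨N, hN, hloj⟩ := poly_loj m (d * 2)
  have hNr : (2 : ℝ) ≤ N := by exact_mod_cast hN
  refine ⟨1 / N, by positivity, by rw [div_lt_one (by linarith)]; linarith, ?_⟩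
  intro k P hP δ hδ τ γ0 hτ hτ0 hγ0 _ e j x hx
  let p : MvPolynomial (Fin m) ℝ := ∑ i, P i ^ 2
  have hfun : (fun z : Euc m => ∑ i : Fin k, (MvPolynomial.eval (fun k => z k) (P i)) ^ 2)
      = evE p := by
    funext z
    simp [p, evE]
  have hdeg : p.totalDegree ≤ d * 2 := by
    refine MvPolynomial.totalDegree_finsetSum_le fun i _ => ?_
    refine (MvPolynomial.totalDegree_pow _ _).trans ?_
    have := hP i
    omega
  have hpos : ∀ z, 0 ≤ evE p z := by
    intro z
    rw [← hfun]
    exact Finset.sum_nonneg fun i _ => sq_nonneg _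
  rw [hfun] at hx ⊢
  refine qng_main hm (evE p) ((evE_contDiff p 1).differentiable (by simp))
    (evE_grad_contDiff p).continuous ((evE_grad_contDiff p).continuous_fderiv (by simp)) hpos N hN
    (hloj p hdeg) δ hδ τ γ0 hτ ?_ hγ0 e j x hx
  rw [Nat.cast_sub (by omega), Nat.cast_one]
  have h1 : τ * N ≤ 1 := by
    rw [le_div_iff₀ (by linarith)] at hτ0
    exact hτ0
  nlinarith
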